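/- For natural numbers n and d with n ≥ 2d ≥ 2, the binomial coefficients satisfy (n choose d) - ((n - d) choose d) ≤ d^2 * (n choose (d-1)) * d. -/

import Mathlib

theorem Nat.choose_add_succ_le (m k e : ℕ) :
    (m + k).choose (e + 1) ≤ m.choose (e + 1) + k * (m + k).choose e := by
  induction k with
  | zero => simp
  | succ k ih =>
    have hmono : (m + k).choose e ≤ (m + (k + 1)).choose e :=
      Nat.choose_le_choose e (by omega)
    have hpascal : (m + (k + 1)).choose (e + 1) = (m + k).choose e + (m + k).choose (e + 1) :=
      Nat.choose_succ_succ (m + k) e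
    nlinarith [Nat.mul_le_mul_left k hmono]

/-- Binomial bound used in the complexity analysis of the vertex enumeration algorithm:
for `n ≥ 2d ≥ 2`, `C(n,d) - C(n-d,d) ≤ d^2 · C(n,d-1) · d`. -/
theorem binomial_difference_bound (n d : ℕ) (hd : 1 ≤ d) (h : 2 * d ≤ n) :
    n.choose d - (n - d).choose d ≤ d ^ 2 * n.choose (d - 1) * d := by
  have key := Nat.choose_add_succ_le (n - d) d (d - 1)
  rw [Nat.sub_add_cancel hd, Nat.sub_add_cancel (by omega : d ≤ n)] at key
  calc n.choose d - (n - d).choose d ≤ d * n.choose (d - 1) := Nat.sub_le_iff_le_add'.2 key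
    _ ≤ d ^ 2 * n.choose (d - 1) := Nat.mul_le_mul_right _ (Nat.le_self_pow two_ne_zero d)
    _ ≤ d ^ 2 * n.choose (d - 1) * d := Nat.le_mul_of_pos_right _ hd
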